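/- Fix a unit pure quaternion μ and integers n, l ≥ 1. Then: (a) the identity tensor is a two-sided identity for the gQt-product, i.e. I_{nnl} *_μ A = A *_μ I_{nnl} = A for all A ∈ ℍ^{n×n×l}; (b) the gQt-product is associative: (A *_μ B) *_μ C = A *_μ (B *_μ C) for all A, B, C ∈ ℍ^{n×n×l}; (c) if A and B are invertible with respect to *_μ, then so is A *_μ B. Consequently, the collection of all invertible n×n×l quaternion tensors forms a group under the gQt-product. -/

import Mathlib

noncomputable section
open Matrix Kronecker Filter Topology

namespace QTpaper

/-- The quaternion unit `i`. -/
def qi : Quaternion ℝ := ⟨0, 1, 0, 0⟩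
/-- The quaternion unit `j`. -/
def qj : Quaternion ℝ := ⟨0, 0, 1, 0⟩
/-- The quaternion unit `k`. -/
def qk : Quaternion ℝ := ⟨0, 0, 0, 1⟩

/-- A unit pure quaternion: zero real part and norm one. -/
def UnitPure (μ : Quaternion ℝ) : Prop := μ.re = 0 ∧ ‖μ‖ = 1

/-- Third-order quaternion tensors. -/
abbrev QTensor (a b c : ℕ) := Fin a → Fin b → Fin c → Quaternion ℝ

/-- `l`-th frontal slice of a third-order tensor. -/
def fslice {a b c : ℕ} (A : QTensor a b c) (l : Fin c) :
    Matrix (Fin a) (Fin b) (Quaternion ℝ) := fun p q => A p q l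

/-- Frobenius norm of a quaternion matrix. -/
def frobM {m n : ℕ} (A : Matrix (Fin m) (Fin n) (Quaternion ℝ)) : ℝ :=
  Real.sqrt (∑ p, ∑ q, ‖A p q‖ ^ 2)

/-- Frobenius norm of a third-order quaternion tensor. -/
def frobT {a b c : ℕ} (A : QTensor a b c) : ℝ :=
  Real.sqrt (∑ p, ∑ q, ∑ l, ‖A p q l‖ ^ 2)

/-- The normalized QDFT matrix `F_{μ,n}` with entries
`(1/√n)·ω^{(p-1)(q-1)}`, `ω^m = cos(2πm/n) − μ·sin(2πm/n)`. -/
def Fq (μ : Quaternion ℝ) (n : ℕ) : Matrix (Fin n) (Fin n) (Quaternion ℝ) :=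
  fun p q =>
    ((1 / Real.sqrt n : ℝ) : Quaternion ℝ) *
      (((Real.cos (2 * Real.pi * (p.1 * q.1) / n) : ℝ) : Quaternion ℝ)
        - ((Real.sin (2 * Real.pi * (p.1 * q.1) / n) : ℝ) : Quaternion ℝ) * μ)

/-- The permutation matrix `P_n` (1-based: `P₁₁ = 1`, `P_{pq} = 1` for `p+q = n+2`). -/
def Pmat (n : ℕ) : Matrix (Fin n) (Fin n) ℝ :=
  fun p q => if (p.1 = 0 ∧ q.1 = 0) ∨ (p.1 + q.1 = n) then 1 else 0

/-- Block circulant matrix of a third-order tensor. -/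
def circ {a b c : ℕ} (A : QTensor a b c) :
    Matrix (Fin c × Fin a) (Fin c × Fin b) (Quaternion ℝ) :=
  fun pi qj => A pi.2 qj.2 (pi.1 - qj.1)

/-- `unfold` stacks the frontal slices vertically. -/
def unfold3 {a b c : ℕ} (A : QTensor a b c) :
    Matrix (Fin c × Fin a) (Fin b) (Quaternion ℝ) :=
  fun pi q => A pi.2 q pi.1

/-- `fold` is the inverse of `unfold`. -/
def fold3 {a b c : ℕ} (M : Matrix (Fin c × Fin a) (Fin b) (Quaternion ℝ)) :
    QTensor a b c := fun p q l => M (l, p) q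

/-- Block diagonal matrix whose `l`-th diagonal block is the `l`-th frontal slice. -/
def diagT {a b c : ℕ} (A : QTensor a b c) :
    Matrix (Fin c × Fin a) (Fin c × Fin b) (Quaternion ℝ) :=
  fun pi qj => if pi.1 = qj.1 then A pi.2 qj.2 pi.1 else 0

/-- The QDFT along mode 3: `fft(A)(p,q,:) = √n₃ · F_{μ,n₃} · A(p,q,:)`. -/
def fftT {a b c : ℕ} (μ : Quaternion ℝ) (A : QTensor a b c) : QTensor a b c :=
  fun p q l => ((Real.sqrt c : ℝ) : Quaternion ℝ) * ∑ m, Fq μ c l m * A p q m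

/-- Real-part component tensor. -/
def compE {a b c : ℕ} (A : QTensor a b c) : QTensor a b c :=
  fun p q l => (((A p q l).re : ℝ) : Quaternion ℝ)
/-- `i`-component tensor. -/
def compI {a b c : ℕ} (A : QTensor a b c) : QTensor a b c :=
  fun p q l => (((A p q l).imI : ℝ) : Quaternion ℝ)
/-- `j`-component tensor. -/
def compJ {a b c : ℕ} (A : QTensor a b c) : QTensor a b c :=
  fun p q l => (((A p q l).imJ : ℝ) : Quaternion ℝ)
/-- `k`-component tensor. -/
def compK {a b c : ℕ} (A : QTensor a b c) : QTensor a b c :=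
  fun p q l => (((A p q l).imK : ℝ) : Quaternion ℝ)

/-- For `μ = a·i + b·j + c·k`, `μ_i = a·i − b·j − c·k`. -/
def mui (μ : Quaternion ℝ) : Quaternion ℝ := ⟨0, μ.imI, -μ.imJ, -μ.imK⟩
/-- For `μ = a·i + b·j + c·k`, `μ_j = −a·i + b·j − c·k`. -/
def muj (μ : Quaternion ℝ) : Quaternion ℝ := ⟨0, -μ.imI, μ.imJ, -μ.imK⟩
/-- For `μ = a·i + b·j + c·k`, `μ_k = −a·i − b·j + c·k`. -/
def muk (μ : Quaternion ℝ) : Quaternion ℝ := ⟨0, -μ.imI, -μ.imJ, μ.imK⟩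

/-- `T` matrix `F_{ν,n}^* · F_{μ,n}`. -/
def Tm (ν μ : Quaternion ℝ) (n : ℕ) : Matrix (Fin n) (Fin n) (Quaternion ℝ) :=
  (Fq ν n)ᴴ * Fq μ n

/-- The gQt-product of third-order quaternion tensors. -/
def gQt {n₁ r n₂ n₃ : ℕ} (μ : Quaternion ℝ) (A : QTensor n₁ r n₃)
    (B : QTensor r n₂ n₃) : QTensor n₁ n₂ n₃ :=
  fold3 ((circ (compE A)
      + qi • (circ (compI A) * (Tm (mui μ) μ n₃ ⊗ₖ (1 : Matrix (Fin r) (Fin r) (Quaternion ℝ))))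
      + qj • (circ (compJ A) * (Tm (muj μ) μ n₃ ⊗ₖ (1 : Matrix (Fin r) (Fin r) (Quaternion ℝ))))
      + qk • (circ (compK A) * (Tm (muk μ) μ n₃ ⊗ₖ (1 : Matrix (Fin r) (Fin r) (Quaternion ℝ)))))
    * unfold3 B)

/-- The index reversal `1 ↦ 1`, `l ↦ n₃ + 2 − l` (1-based), used in the tensor transpose. -/
def revIdx {c : ℕ} (l : Fin c) : Fin c :=
  if h : l.1 = 0 then l else ⟨c - l.1, by have := l.2; omega⟩

/-- Transpose of a (componentwise real) tensor: transpose each frontal slice and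
reverse the order of the transposed slices `2` through `n₃`. -/
def transT {a b c : ℕ} (A : QTensor a b c) : QTensor b a c :=
  fun q p l => A p q (revIdx l)

/-- Right multiplication of a matrix by a quaternion scalar. -/
def rmulM {m n : Type*} (M : Matrix m n (Quaternion ℝ)) (x : Quaternion ℝ) :
    Matrix m n (Quaternion ℝ) := fun p q => M p q * x

/-- Conjugate transpose of a third-order quaternion tensor. -/
def conjT {n₁ n₂ n₃ : ℕ} (μ : Quaternion ℝ) (A : QTensor n₁ n₂ n₃) : QTensor n₂ n₁ n₃ :=
  fold3 (unfold3 (transT (compE A))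
    - rmulM (((Tm (mui μ) μ n₃)ᴴ ⊗ₖ (1 : Matrix (Fin n₂) (Fin n₂) (Quaternion ℝ)))
        * unfold3 (transT (compI A))) qi
    - rmulM (((Tm (muj μ) μ n₃)ᴴ ⊗ₖ (1 : Matrix (Fin n₂) (Fin n₂) (Quaternion ℝ)))
        * unfold3 (transT (compJ A))) qj
    - rmulM (((Tm (muk μ) μ n₃)ᴴ ⊗ₖ (1 : Matrix (Fin n₂) (Fin n₂) (Quaternion ℝ)))
        * unfold3 (transT (compK A))) qk)

/-- The identity tensor: first frontal slice is the identity, the others vanish. -/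
def idT (n l : ℕ) : QTensor n n l :=
  fun p q m => if m.1 = 0 ∧ p = q then 1 else 0

/-- Unitary tensor with respect to the gQt-product. -/
def unitaryT {n n₃ : ℕ} (μ : Quaternion ℝ) (U : QTensor n n n₃) : Prop :=
  gQt μ (conjT μ U) U = idT n n₃ ∧ gQt μ U (conjT μ U) = idT n n₃

/-- f-diagonal tensor: each frontal slice is a diagonal matrix. -/
def fDiag {a b c : ℕ} (S : QTensor a b c) : Prop :=
  ∀ p q l, p.1 ≠ q.1 → S p q l = 0


/-- The normalized complex DFT matrix. -/
def dftMatrix (n : ℕ) : Matrix (Fin n) (Fin n) ℂ :=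
  fun p q => ((1 / Real.sqrt n : ℝ) : ℂ) *
    Complex.exp (-(2 * Real.pi * Complex.I / n)) ^ (p.1 * q.1)

theorem isPrimitiveRoot_exp_neg (n : ℕ) [NeZero n] :
    IsPrimitiveRoot (Complex.exp (-(2 * Real.pi * Complex.I / n))) n := by
  rw [Complex.exp_neg]
  exact (Complex.isPrimitiveRoot_exp n (NeZero.ne n)).inv

theorem exp_pow_mul_add_val (n : ℕ) [NeZero n] (m s t : Fin n) :
    Complex.exp (-(2 * Real.pi * Complex.I / n)) ^ (m.1 * (s + t).1) =
      Complex.exp (-(2 * Real.pi * Complex.I / n)) ^ (m.1 * s.1) *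
        Complex.exp (-(2 * Real.pi * Complex.I / n)) ^ (m.1 * t.1) := by
  rw [← pow_add, ← mul_add]
  refine pow_eq_pow_of_modEq ?_ (isPrimitiveRoot_exp_neg n).pow_eq_one
  rw [Fin.val_add]
  exact (Nat.mod_modEq _ _).mul_left _

theorem dftMatrix_mul_circulant (n : ℕ) (a : Fin n → ℂ) :
    dftMatrix n * circulant a =
      diagonal (((Real.sqrt n : ℝ) : ℂ) • (dftMatrix n *ᵥ a)) * dftMatrix n := by
  rcases n.eq_zero_or_pos with rfl | hn
  · ext p; exact p.elim0
  have : NeZero n := ⟨hn.ne'⟩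
  have hs : ((Real.sqrt n : ℝ) : ℂ) ≠ 0 := by
    exact_mod_cast (Real.sqrt_pos.2 (by exact_mod_cast hn)).ne'
  ext m t
  rw [diagonal_mul, mul_apply]
  simp only [circulant_apply, Pi.smul_apply, mulVec, dotProduct, smul_eq_mul]
  rw [← Equiv.sum_comp (Equiv.addRight t), Finset.mul_sum, Finset.sum_mul]
  refine Finset.sum_congr rfl fun s _ => ?_
  simp only [Equiv.coe_addRight, add_sub_cancel_right, dftMatrix, exp_pow_mul_add_val]
  push_cast
  field_simp

theorem dftMatrix_conjTranspose_mul_self (n : ℕ) : (dftMatrix n)ᴴ * dftMatrix n = 1 := by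
  rcases n.eq_zero_or_pos with rfl | hn
  · ext p; exact p.elim0
  have : NeZero n := ⟨hn.ne'⟩
  have hn0 : (n : ℂ) ≠ 0 := by exact_mod_cast hn.ne'
  have hsq : ((1 / Real.sqrt n : ℝ) : ℂ) * ((1 / Real.sqrt n : ℝ) : ℂ) = 1 / n := by
    rw [← Complex.ofReal_mul, div_mul_div_comm, Real.mul_self_sqrt (Nat.cast_nonneg n)]
    simp
  have hζ := isPrimitiveRoot_exp_neg n
  have hstar : star (Complex.exp (-(2 * Real.pi * Complex.I / n))) =
      (Complex.exp (-(2 * Real.pi * Complex.I / n)))⁻¹ := by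
    rw [← Complex.exp_neg, Complex.star_def, ← Complex.exp_conj]
    simp [neg_div, Complex.conj_ofNat]
  ext s t
  simp only [mul_apply, conjTranspose_apply, dftMatrix, star_mul', star_pow, hstar]
  generalize Complex.exp (-(2 * Real.pi * Complex.I / n)) = ζ at hζ
  have hζ0 : ζ ≠ 0 := hζ.ne_zero hn.ne'
  have hterm : ∀ m : Fin n, star ((1 / Real.sqrt n : ℝ) : ℂ) * ζ⁻¹ ^ (m.1 * s.1) *
      (((1 / Real.sqrt n : ℝ) : ℂ) * ζ ^ (m.1 * t.1)) =
      1 / n * ((ζ ^ t.1 / ζ ^ s.1) ^ m.1) := by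
    intro m
    rw [Complex.star_def, Complex.conj_ofReal, mul_mul_mul_comm, hsq, mul_comm m.1 s.1,
      mul_comm m.1 t.1, pow_mul, pow_mul, ← mul_pow, inv_pow, mul_comm (ζ ^ s.1)⁻¹,
      ← div_eq_mul_inv]
  rw [Finset.sum_congr rfl fun m _ => hterm m, ← Finset.mul_sum,
    Fin.sum_univ_eq_sum_range (fun k => (ζ ^ t.1 / ζ ^ s.1) ^ k) n]
  by_cases h : s = t
  · subst h
    simp [hζ0, hn0]
  · have hne : ζ ^ t.1 / ζ ^ s.1 ≠ 1 := by
      rw [Ne, div_eq_one_iff_eq (pow_ne_zero _ hζ0)]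
      exact fun e => h (Fin.ext (hζ.pow_inj t.2 s.2 e).symm)
    rw [geom_sum_eq hne, div_pow, ← pow_mul, ← pow_mul, mul_comm t.1, mul_comm s.1,
      pow_mul, pow_mul, hζ.pow_eq_one]
    simp [h]

theorem UnitPure.mul_self {μ : Quaternion ℝ} (h : UnitPure μ) : μ * μ = -1 := by
  have hstar : star μ = -μ := by
    ext <;> simp [h.1]
  have := Quaternion.self_mul_star μ
  rw [hstar, Quaternion.normSq_eq_norm_mul_self, h.2] at this
  simpa [neg_eq_iff_eq_neg] using this

theorem UnitPure.norm_sq_eq {μ : Quaternion ℝ} (h : UnitPure μ) :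
    μ.imI ^ 2 + μ.imJ ^ 2 + μ.imK ^ 2 = 1 := by
  have := Quaternion.normSq_def' μ
  rw [Quaternion.normSq_eq_norm_mul_self, h.1, h.2] at this
  linarith

theorem unitPure_of_sq {μ : Quaternion ℝ} (h0 : μ.re = 0)
    (h : μ.imI ^ 2 + μ.imJ ^ 2 + μ.imK ^ 2 = 1) : UnitPure μ := by
  refine ⟨h0, ?_⟩
  have hsq : ‖μ‖ ^ 2 = 1 := by
    rw [sq, ← Quaternion.normSq_eq_norm_mul_self, Quaternion.normSq_def', h0]
    linarith
  exact (pow_eq_one_iff_of_nonneg (norm_nonneg μ) two_ne_zero).1 hsq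

theorem UnitPure.mui {μ : Quaternion ℝ} (h : UnitPure μ) : UnitPure (mui μ) :=
  unitPure_of_sq rfl (by simpa [QTpaper.mui] using h.norm_sq_eq)

theorem UnitPure.muj {μ : Quaternion ℝ} (h : UnitPure μ) : UnitPure (muj μ) :=
  unitPure_of_sq rfl (by simpa [QTpaper.muj] using h.norm_sq_eq)

theorem UnitPure.muk {μ : Quaternion ℝ} (h : UnitPure μ) : UnitPure (muk μ) :=
  unitPure_of_sq rfl (by simpa [QTpaper.muk] using h.norm_sq_eq)

theorem mul_qi {μ : Quaternion ℝ} (h : UnitPure μ) : μ * qi = qi * mui μ := by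
  ext <;>
    simp only [Quaternion.re_mul, Quaternion.imI_mul, Quaternion.imJ_mul, Quaternion.imK_mul] <;>
    simp [qi, mui, h.1]

theorem mul_qj {μ : Quaternion ℝ} (h : UnitPure μ) : μ * qj = qj * muj μ := by
  ext <;>
    simp only [Quaternion.re_mul, Quaternion.imI_mul, Quaternion.imJ_mul, Quaternion.imK_mul] <;>
    simp [qj, muj, h.1]

theorem mul_qk {μ : Quaternion ℝ} (h : UnitPure μ) : μ * qk = qk * muk μ := by
  ext <;>
    simp only [Quaternion.re_mul, Quaternion.imI_mul, Quaternion.imJ_mul, Quaternion.imK_mul] <;>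
    simp [qk, muk, h.1]

/-- The embedding `ℂ → ℍ` sending the imaginary unit to a unit pure quaternion. -/
def complexEmb {μ : Quaternion ℝ} (h : UnitPure μ) : ℂ →ₐ[ℝ] Quaternion ℝ :=
  Complex.liftAux μ h.mul_self

theorem complexEmb_apply {μ : Quaternion ℝ} (h : UnitPure μ) (z : ℂ) :
    complexEmb h z = (z.re : Quaternion ℝ) + (z.im : Quaternion ℝ) * μ := by
  rw [complexEmb, Complex.liftAux_apply, Quaternion.coe_mul_eq_smul]
  rfl

theorem complexEmb_ofReal {μ : Quaternion ℝ} (h : UnitPure μ) (r : ℝ) :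
    complexEmb h (r : ℂ) = (r : Quaternion ℝ) := by
  simp

theorem complexEmb_star {μ : Quaternion ℝ} (h : UnitPure μ) (z : ℂ) :
    complexEmb h (star z) = star (complexEmb h z) := by
  rw [complexEmb_apply, complexEmb_apply]
  ext <;> simp [h.1, mul_comm]

theorem Fq_eq_map {μ : Quaternion ℝ} (h : UnitPure μ) (n : ℕ) :
    Fq μ n = (dftMatrix n).map (complexEmb h) := by
  ext1 p q
  rw [map_apply, dftMatrix, map_mul, complexEmb_ofReal, ← Complex.exp_nat_mul,
    show ((p.1 * q.1 : ℕ) : ℂ) * -(2 * Real.pi * Complex.I / n) =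
      ((-(2 * Real.pi * (p.1 * q.1) / n) : ℝ) : ℂ) * Complex.I by push_cast; ring,
    complexEmb_apply, Complex.exp_ofReal_mul_I_re, Complex.exp_ofReal_mul_I_im,
    Real.cos_neg, Real.sin_neg, Fq, Quaternion.coe_neg, neg_mul, sub_eq_add_neg]

theorem Fq_conjTranspose_mul_self {μ : Quaternion ℝ} (h : UnitPure μ) (n : ℕ) :
    (Fq μ n)ᴴ * Fq μ n = 1 := by
  rw [Fq_eq_map h, ← conjTranspose_map _ (complexEmb_star h), ← Matrix.map_mul,
    dftMatrix_conjTranspose_mul_self, Matrix.map_one _ (map_zero _) (map_one _)]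

theorem Fq_mul_conjTranspose_self {μ : Quaternion ℝ} (h : UnitPure μ) (n : ℕ) :
    Fq μ n * (Fq μ n)ᴴ = 1 := by
  rw [Fq_eq_map h, ← conjTranspose_map _ (complexEmb_star h), ← Matrix.map_mul,
    mul_eq_one_comm.1 (dftMatrix_conjTranspose_mul_self n),
    Matrix.map_one _ (map_zero _) (map_one _)]

theorem Fq_mul_circulant {μ : Quaternion ℝ} (h : UnitPure μ) (n : ℕ) (a : Fin n → ℝ) :
    Fq μ n * circulant (fun s => (a s : Quaternion ℝ)) =
      diagonal (((Real.sqrt n : ℝ) : Quaternion ℝ) •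
        (Fq μ n *ᵥ fun s => (a s : Quaternion ℝ))) * Fq μ n := by
  have key := congrArg (fun M => M.map (complexEmb h))
    (dftMatrix_mul_circulant n fun s => (a s : ℂ))
  simp only [Matrix.map_mul, ← Fq_eq_map h] at key
  convert key using 2
  · ext1 s t
    simp [circulant_apply]
  · rw [diagonal_map (map_zero _)]
    congr 1
    ext1 m
    simp [Fq_eq_map h, mulVec, dotProduct]

theorem Fq_mul_of_semiconj {μ ν x : Quaternion ℝ} (hx : μ * x = x * ν) (n : ℕ) (p q : Fin n) :
    Fq μ n p q * x = x * Fq ν n p q := by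
  simp only [Fq, mul_assoc, sub_mul, hx, mul_sub, Quaternion.coe_mul_eq_smul,
    Quaternion.mul_coe_eq_smul, smul_mul_assoc, mul_smul_comm]

theorem Fq_mul_smul_circulant_mul_Tm {μ ν x : Quaternion ℝ} (hν : UnitPure ν)
    (hx : μ * x = x * ν) (n : ℕ) (a : Fin n → ℝ) :
    Fq μ n * (x • (circulant (fun s => (a s : Quaternion ℝ)) * Tm ν μ n)) =
      diagonal (((Real.sqrt n : ℝ) : Quaternion ℝ) • (Fq μ n *ᵥ fun s => x * a s)) *
        Fq μ n := by
  have hcomm : ∀ M : Matrix (Fin n) (Fin n) (Quaternion ℝ),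
      Fq μ n * (x • M) = x • (Fq ν n * M) := by
    intro M
    ext1 p q
    simp only [mul_apply, Matrix.smul_apply, smul_eq_mul, Finset.mul_sum, ← mul_assoc,
      Fq_mul_of_semiconj hx]
  rw [hcomm, ← Matrix.mul_assoc, Fq_mul_circulant hν, Tm, Matrix.mul_assoc,
    ← Matrix.mul_assoc (Fq ν n), Fq_mul_conjTranspose_self hν, Matrix.one_mul]
  ext1 p q
  simp only [Matrix.smul_apply, diagonal_mul, Pi.smul_apply, smul_eq_mul, mulVec, dotProduct,
    ← mul_assoc, Fq_mul_of_semiconj hx]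
  simp only [mul_assoc, ← Finset.mul_sum]
  rw [← mul_assoc, ← mul_assoc, ← mul_assoc, ← Quaternion.coe_commutes _ x]
  simp only [mul_assoc]

/-- The matrix by which a tube acts on tubes through the gQt-product. -/
def tubeMatrix {n : ℕ} (μ : Quaternion ℝ) (a : Fin n → Quaternion ℝ) :
    Matrix (Fin n) (Fin n) (Quaternion ℝ) :=
  circulant (fun s => ((a s).re : Quaternion ℝ))
    + qi • (circulant (fun s => ((a s).imI : Quaternion ℝ)) * Tm (mui μ) μ n)
    + qj • (circulant (fun s => ((a s).imJ : Quaternion ℝ)) * Tm (muj μ) μ n)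
    + qk • (circulant (fun s => ((a s).imK : Quaternion ℝ)) * Tm (muk μ) μ n)

theorem gQt_apply {n₁ r n₂ n₃ : ℕ} (μ : Quaternion ℝ) (A : QTensor n₁ r n₃)
    (B : QTensor r n₂ n₃) (p : Fin n₁) (q : Fin n₂) :
    gQt μ A B p q = ∑ v, tubeMatrix μ (A p v) *ᵥ B v q := by
  have hkron : ∀ (C : QTensor n₁ r n₃) (T : Matrix (Fin n₃) (Fin n₃) (Quaternion ℝ))
      (s t : Fin n₃) (v : Fin r),
      (circ C * (T ⊗ₖ (1 : Matrix (Fin r) (Fin r) (Quaternion ℝ)))) (s, p) (t, v) =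
        (circulant (C p v) * T) s t := by
    intro C T s t v
    simp [mul_apply, Fintype.sum_prod_type, circ, kroneckerMap_apply, one_apply]
  ext1 s
  simp only [gQt, fold3, mul_apply (M := _ + _), unfold3, Fintype.sum_prod_type_right,
    Finset.sum_apply, mulVec, dotProduct, Matrix.add_apply, Matrix.smul_apply, hkron, tubeMatrix]
  rfl

theorem Fq_mul_tubeMatrix {n : ℕ} {μ : Quaternion ℝ} (h : UnitPure μ)
    (a : Fin n → Quaternion ℝ) :
    Fq μ n * tubeMatrix μ a =
      diagonal (((Real.sqrt n : ℝ) : Quaternion ℝ) • (Fq μ n *ᵥ a)) * Fq μ n := by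
  have ha : a = (fun s => ((a s).re : Quaternion ℝ)) + (fun s => qi * ((a s).imI : Quaternion ℝ))
      + (fun s => qj * ((a s).imJ : Quaternion ℝ))
      + (fun s => qk * ((a s).imK : Quaternion ℝ)) := by
    ext s <;> simp only [Pi.add_apply, Quaternion.re_add, Quaternion.imI_add, Quaternion.imJ_add,
      Quaternion.imK_add, Quaternion.re_mul, Quaternion.imI_mul, Quaternion.imJ_mul,
      Quaternion.imK_mul] <;> simp [qi, qj, qk]
  conv_rhs => rw [ha]
  rw [tubeMatrix, Matrix.mul_add, Matrix.mul_add, Matrix.mul_add, Fq_mul_circulant h,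
    Fq_mul_smul_circulant_mul_Tm h.mui (mul_qi h), Fq_mul_smul_circulant_mul_Tm h.muj (mul_qj h),
    Fq_mul_smul_circulant_mul_Tm h.muk (mul_qk h)]
  simp only [mulVec_add, smul_add, ← Matrix.add_mul, diagonal_add]
  rfl

theorem fftT_apply {a b c : ℕ} (μ : Quaternion ℝ) (A : QTensor a b c) (p : Fin a) (q : Fin b) :
    fftT μ A p q = ((Real.sqrt c : ℝ) : Quaternion ℝ) • (Fq μ c *ᵥ A p q) := rfl

/-- The QDFT turns the gQt-product into the slicewise matrix product. -/
theorem fslice_fftT_gQt {n₁ r n₂ n₃ : ℕ} {μ : Quaternion ℝ} (h : UnitPure μ)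
    (A : QTensor n₁ r n₃) (B : QTensor r n₂ n₃) (m : Fin n₃) :
    fslice (fftT μ (gQt μ A B)) m = fslice (fftT μ A) m * fslice (fftT μ B) m := by
  ext1 p q
  simp only [fslice, mul_apply, fftT_apply, gQt_apply, mulVec_sum, mulVec_mulVec,
    Fq_mul_tubeMatrix h, Finset.smul_sum, Finset.sum_apply]
  refine Finset.sum_congr rfl fun v _ => ?_
  rw [← mulVec_mulVec]
  simp only [Pi.smul_apply, mulVec_diagonal, smul_eq_mul, Quaternion.coe_mul_eq_smul,
    smul_mul_assoc, mul_smul_comm]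

theorem fslice_fftT_idT (μ : Quaternion ℝ) (n l : ℕ) (m : Fin l) :
    fslice (fftT μ (idT n l)) m = 1 := by
  have : NeZero l := ⟨m.pos.ne'⟩
  have hs : Real.sqrt l ≠ 0 := (Real.sqrt_pos.2 (by exact_mod_cast m.pos)).ne'
  have hs' : ((Real.sqrt l : ℝ) : Quaternion ℝ) * ((Real.sqrt l : ℝ) : Quaternion ℝ)⁻¹ = 1 := by
    rw [← Quaternion.coe_inv, ← Quaternion.coe_mul, mul_inv_cancel₀ hs, Quaternion.coe_one]
  ext1 p q
  by_cases hpq : p = q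
  · subst hpq
    have hval : ∀ s : Fin l, (s.1 = 0) = (s = 0) := fun s => by rw [Fin.ext_iff, Fin.val_zero]
    simp only [fslice, fftT, idT, one_apply_eq, and_true, hval, mul_ite, mul_one, mul_zero,
      Finset.sum_ite_eq', Finset.mem_univ, if_true]
    simp [Fq, hs']
  · simp [fslice, fftT, idT, hpq]

theorem fftT_injective {a b c : ℕ} {μ : Quaternion ℝ} (h : UnitPure μ) {A B : QTensor a b c}
    (hAB : ∀ m, fslice (fftT μ A) m = fslice (fftT μ B) m) : A = B := by
  ext1 p
  ext1 q
  rcases c.eq_zero_or_pos with rfl | hc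
  · exact Subsingleton.elim _ _
  have hs : ((Real.sqrt c : ℝ) : Quaternion ℝ) ≠ 0 := by
    rw [Ne, ← Quaternion.coe_zero, Quaternion.coe_inj]
    exact (Real.sqrt_pos.2 (by exact_mod_cast hc)).ne'
  have hF : Fq μ c *ᵥ A p q = Fq μ c *ᵥ B p q := by
    ext1 m
    exact mul_left_cancel₀ hs (congrFun (congrFun (hAB m) p) q)
  simpa [mulVec_mulVec, Fq_conjTranspose_mul_self h] using
    congrArg (fun x => (Fq μ c)ᴴ *ᵥ x) hF

theorem gQt_assoc {n₁ n₂ n₃ n₄ l : ℕ} {μ : Quaternion ℝ} (h : UnitPure μ)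
    (A : QTensor n₁ n₂ l) (B : QTensor n₂ n₃ l) (C : QTensor n₃ n₄ l) :
    gQt μ (gQt μ A B) C = gQt μ A (gQt μ B C) :=
  fftT_injective h fun m => by simp only [fslice_fftT_gQt h, Matrix.mul_assoc]

theorem idT_gQt {n₁ n₂ l : ℕ} {μ : Quaternion ℝ} (h : UnitPure μ) (A : QTensor n₁ n₂ l) :
    gQt μ (idT n₁ l) A = A :=
  fftT_injective h fun m => by rw [fslice_fftT_gQt h, fslice_fftT_idT, Matrix.one_mul]

theorem gQt_idT {n₁ n₂ l : ℕ} {μ : Quaternion ℝ} (h : UnitPure μ) (A : QTensor n₁ n₂ l) :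
    gQt μ A (idT n₂ l) = A :=
  fftT_injective h fun m => by rw [fslice_fftT_gQt h, fslice_fftT_idT, Matrix.mul_one]

/-- identity laws, associativity, and closure of invertibles, so the
invertible `n×n×l` quaternion tensors form a group under the gQt-product. -/
theorem gQt_group_structure (μ : Quaternion ℝ) (hμ : UnitPure μ)
    (n l : ℕ) (hn : 1 ≤ n) (hl : 1 ≤ l) :
    (∀ A : QTensor n n l, gQt μ (idT n l) A = A ∧ gQt μ A (idT n l) = A) ∧
    (∀ A B C : QTensor n n l, gQt μ (gQt μ A B) C = gQt μ A (gQt μ B C)) ∧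
    (∀ A B : QTensor n n l,
        (∃ A' : QTensor n n l, gQt μ A A' = idT n l ∧ gQt μ A' A = idT n l) →
        (∃ B' : QTensor n n l, gQt μ B B' = idT n l ∧ gQt μ B' B = idT n l) →
        ∃ C' : QTensor n n l,
          gQt μ (gQt μ A B) C' = idT n l ∧ gQt μ C' (gQt μ A B) = idT n l) := by
  refine ⟨fun A => ⟨idT_gQt hμ A, gQt_idT hμ A⟩, gQt_assoc hμ, ?_⟩
  rintro A B ⟨A', hA, hA'⟩ ⟨B', hB, hB'⟩
  refine ⟨gQt μ B' A', ?_, ?_⟩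
  · rw [gQt_assoc hμ, ← gQt_assoc hμ B, hB, idT_gQt hμ, hA]
  · rw [gQt_assoc hμ, ← gQt_assoc hμ A', hA', idT_gQt hμ, hB']

end QTpaper
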